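/- arXiv:1712.10095 — 4 statements merged into one kernel-verified Lean document; each statement's English description precedes it below -/
import Mathlib

section
/- Let m, D, s be natural numbers, let Ψ be a real m × D matrix and let y ∈ ℝ^m. Suppose x̄ ∈ ℝ^D satisfies Ψ x̄ = y and ‖x̄‖₀ ≤ s, suppose 2s ≤ D, and suppose that every set of 2s columns of Ψ is linearly independent. Then x̄ is the unique s-sparse solution: every x ∈ ℝ^D with Ψ x = y and ‖x‖₀ ≤ s satisfies x = x̄. -/
/-- The "ℓ₀-norm" of a vector: the number of nonzero entries. -/
noncomputable def l0norm {D : ℕ} (x : Fin D → ℝ) : ℕ := (Function.support x).ncard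

/-- Unique retrieval of the sparsest solution: if `xbar` is an `s`-sparse solution of
`Ψ x = y`, `2 s ≤ D`, and every set of `2 s` columns of `Ψ` is linearly independent,
then `xbar` is the unique `s`-sparse solution. -/
theorem unique_sparse_solution {m D s : ℕ} (Ψ : Matrix (Fin m) (Fin D) ℝ)
    (y : Fin m → ℝ) (xbar : Fin D → ℝ)
    (hsol : Ψ.mulVec xbar = y) (hsparse : l0norm xbar ≤ s) (hD : 2 * s ≤ D)
    (hcols : ∀ S : Finset (Fin D), S.card = 2 * s →
      LinearIndependent ℝ (fun j : S => Ψ.transpose j.val)) :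
    ∀ x : Fin D → ℝ, Ψ.mulVec x = y → l0norm x ≤ s → x = xbar := by
  intro x hx hxs
  classical
  let T : Finset (Fin D) := (Finset.univ.filter fun i => x i ≠ 0) ∪
    (Finset.univ.filter fun i => xbar i ≠ 0)
  have key : ∀ z : Fin D → ℝ, l0norm z = (Finset.univ.filter fun i => z i ≠ 0).card := by
    intro z
    rw [l0norm, ← Set.ncard_coe_finset]
    congr 1
    ext i
    simp
  have hT : T.card ≤ 2 * s := by
    have h := Finset.card_union_le (Finset.univ.filter fun i => x i ≠ 0)
      (Finset.univ.filter fun i => xbar i ≠ 0)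
    rw [key] at hxs hsparse
    have h2 : T.card ≤ _ := h
    omega
  obtain ⟨S, hTS, hS⟩ := Finset.exists_superset_card_eq hT (by simpa using hD)
  have hout : ∀ i, i ∉ S → x i - xbar i = 0 := by
    intro i hi
    have h : i ∉ T := fun h => hi (hTS h)
    simp only [T, Finset.mem_union, Finset.mem_filter, Finset.mem_univ, true_and, not_or,
      not_not] at h
    rw [h.1, h.2, sub_zero]
  have hli := Fintype.linearIndependent_iff.mp (hcols S hS) (fun j => x j.val - xbar j.val) (by
    have h0 : ∑ j ∈ S, (x j - xbar j) • Ψ.transpose j = 0 := by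
      rw [Finset.sum_subset (Finset.subset_univ S)
        (fun i _ hi => by rw [hout i hi, zero_smul])]
      have h1 : Ψ.mulVec (x - xbar) = 0 := by rw [Matrix.mulVec_sub, hx, hsol, sub_self]
      ext k
      have h2 := congrFun h1 k
      simp only [Matrix.mulVec, dotProduct, Pi.sub_apply, Pi.zero_apply] at h2
      rw [Finset.sum_apply, Pi.zero_apply, ← h2]
      refine Finset.sum_congr rfl fun j _ => ?_
      simp [mul_comm]
    rw [← h0]
    exact Finset.sum_coe_sort S (fun j => (x j - xbar j) • Ψ.transpose j))
  ext i
  by_cases hi : i ∈ S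
  · exact sub_eq_zero.mp (hli ⟨i, hi⟩)
  · exact sub_eq_zero.mp (hout i hi)
end

section
/- Let Ψ be a real m × D matrix, y ∈ ℝ^m, and x̄ ∈ ℝ^D with Ψ x̄ = y. Suppose that every nonzero vector v in the kernel of Ψ satisfies ‖v‖₀ > 2‖x̄‖₀ (equivalently, 2‖x̄‖₀ is strictly less than the spark of Ψ). Then x̄ is the unique sparsest solution of Ψ x = y: every x ∈ ℝ^D with Ψ x = y and x ≠ x̄ satisfies ‖x‖₀ > ‖x̄‖₀. -/
/-- If every nonzero kernel vector of `Ψ` has ℓ₀-norm greater than `2 ‖xbar‖₀`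
(equivalently, `2 ‖xbar‖₀ < spark Ψ`), then `xbar` is the unique sparsest solution
of `Ψ x = y`: any other solution is strictly less sparse. -/
theorem unique_sparsest_solution_of_spark {m D : ℕ} (Ψ : Matrix (Fin m) (Fin D) ℝ)
    (y : Fin m → ℝ) (xbar : Fin D → ℝ) (hsol : Ψ.mulVec xbar = y)
    (hker : ∀ v : Fin D → ℝ, Ψ.mulVec v = 0 → v ≠ 0 → 2 * l0norm xbar < l0norm v) :
    ∀ x : Fin D → ℝ, Ψ.mulVec x = y → x ≠ xbar → l0norm xbar < l0norm x := by
  intro x hx hne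
  have h1 := hker (x - xbar) (by rw [Matrix.mulVec_sub, hx, hsol, sub_self]) (sub_ne_zero.mpr hne)
  have h2 : l0norm (x - xbar) ≤ l0norm x + l0norm xbar := by
    unfold l0norm
    refine le_trans (Set.ncard_le_ncard ?_ (Set.toFinite _)) (Set.ncard_union_le _ _)
    intro i hi
    by_contra h
    simp only [Set.mem_union, Function.mem_support, not_or, not_not] at h
    apply hi
    simp [h.1, h.2]
  omega
end

section
/- (Rank condition, LTV case.) Suppose the matrix Ψ_a built from the state measurements z^{(j)}[k] has full column rank, i.e., rank Ψ_a = n² k_f. Then for every time step k ∈ {0, …, k_f − 1}, the data matrix Z_k ∈ ℝ^{n × q} has full row rank, i.e., rank Z_k = n. -/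
/-- The sensing matrix `Ψₐ` for the LTV case, built from state data
`z j k : ℝⁿ` (experiment `j`, time `k`): rows indexed by `(j, k, i)`, columns by
`(k', i', l)`, entry equal to `z_l^{(j)}[k]` if `k = k'` and `i = i'`, else `0`.
This is the vertical stack over experiments of the block-diagonal matrices with
blocks `Iₙ ⊗ (z^{(j)}[k])ᵀ`. -/
def PsiA (n kf q : ℕ) (z : Fin q → Fin kf → Fin n → ℝ) :
    Matrix (Fin q × Fin kf × Fin n) (Fin kf × Fin n × Fin n) ℝ :=
  fun r c => if r.2.1 = c.1 ∧ r.2.2 = c.2.1 then z r.1 r.2.1 c.2.2 else 0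

/-- The data matrix `Z_k ∈ ℝ^{n × q}`, whose `(i, j)` entry is `z_i^{(j)}[k]`. -/
def Zmat (n kf q : ℕ) (z : Fin q → Fin kf → Fin n → ℝ) (k : Fin kf) :
    Matrix (Fin n) (Fin q) ℝ :=
  fun i j => z j k i

/-- Rank condition, LTV case: if `Ψₐ` has full column rank `n² k_f`, then for every
time step `k` the data matrix `Z_k` has full row rank `n`. -/
theorem Zk_full_row_rank_of_PsiA_full_column_rank
    (n kf q : ℕ) (z : Fin q → Fin kf → Fin n → ℝ)
    (hrank : (PsiA n kf q z).rank = n ^ 2 * kf) :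
    ∀ k : Fin kf, (Zmat n kf q z k).rank = n := by
  intro k
  have hcol : LinearIndependent ℝ (PsiA n kf q z).col := by
    rw [linearIndependent_iff_card_eq_finrank_span, Set.finrank,
      ← Matrix.rank_eq_finrank_span_cols, hrank]
    simp only [Fintype.card_prod, Fintype.card_fin]
    ring
  have hrow : LinearIndependent ℝ (Zmat n kf q z k).row := by
    rw [Fintype.linearIndependent_iff] at hcol ⊢
    intro v hv l
    have h := hcol (fun c => if c.1 = k ∧ c.2.1 = l then v c.2.2 else 0) ?_ (k, l, l)
    · simpa using h
    · ext r
      obtain ⟨j, k', i⟩ := r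
      have hj := congrFun hv j
      simp only [Finset.sum_apply, Pi.smul_apply, smul_eq_mul, Matrix.row, Zmat,
        Pi.zero_apply] at hj
      simp only [Finset.sum_apply, Pi.smul_apply, smul_eq_mul, Matrix.col_apply, PsiA,
        Pi.zero_apply, Fintype.sum_prod_type]
      by_cases hk : k' = k
      · subst hk
        by_cases hi : i = l
        · subst hi
          rw [Finset.sum_eq_single k', Finset.sum_eq_single i]
          · simpa using hj
          · intro b _ hb
            simp [hb]
          · simp
          · intro b _ hb
            simp [hb]
          · simp
        · refine Finset.sum_eq_zero fun a _ => Finset.sum_eq_zero fun b _ =>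
            Finset.sum_eq_zero fun c _ => ?_
          grind
      · refine Finset.sum_eq_zero fun a _ => Finset.sum_eq_zero fun b _ =>
          Finset.sum_eq_zero fun c _ => ?_
        grind
  simpa using hrow.rank_matrix
end

section
/- (Converse rank condition, LTV case.) Suppose that for every time step k ∈ {0, …, k_f − 1} the data matrix Z_k ∈ ℝ^{n × q} has full row rank, i.e., rank Z_k = n. Then the matrix Ψ_a built from the state measurements has full column rank, i.e., rank Ψ_a = n² k_f. -/
/-- Converse rank condition, LTV case: if for every time step `k` the data matrix
`Z_k` has full row rank `n`, then `Ψₐ` has full column rank `n² k_f`. -/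
theorem PsiA_full_column_rank_of_Zk_full_row_rank
    (n kf q : ℕ) (z : Fin q → Fin kf → Fin n → ℝ)
    (hZ : ∀ k : Fin kf, (Zmat n kf q z k).rank = n) :
    (PsiA n kf q z).rank = n ^ 2 * kf := by
  have hli : ∀ k, LinearIndependent ℝ (Zmat n kf q z k).row := by
    intro k
    rw [linearIndependent_iff_card_eq_finrank_span, Set.finrank,
      ← Matrix.rank_eq_finrank_span_row, hZ k, Fintype.card_fin]
  have hP : LinearIndependent ℝ (PsiA n kf q z).transpose.row := by
    rw [Fintype.linearIndependent_iff]
    rintro g hg ⟨k, i, l⟩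
    refine Fintype.linearIndependent_iff.mp (hli k) (fun l => g (k, i, l)) ?_ l
    funext j
    have h := congrFun hg (j, k, i)
    simp only [Finset.sum_apply, Pi.smul_apply, smul_eq_mul, Matrix.row, Matrix.transpose_apply,
      PsiA, Fintype.sum_prod_type, Pi.zero_apply, ite_and, mul_ite, mul_zero] at h
    simpa [Finset.sum_apply, Matrix.row, Zmat] using h
  rw [← Matrix.rank_transpose, hP.rank_matrix]
  simp only [Fintype.card_prod, Fintype.card_fin]
  ring
end
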